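/- Let k be a positive integer and let M, N be nonnegative integers. Then the number of pairs (u, v) of binary words of length M + N, where both u and v have exactly M ones and N zeros, and such that −k < ∑_{j=1}^{s} (u_j − v_j) < k for every s with 1 ≤ s ≤ M + N, equals ∑_{l ∈ ℤ} (−1)^l · C(M+N, M−kl) · C(M+N, N−kl). -/

import Mathlib

/-- Binomial coefficient `C(n, b)` with integer lower index, zero unless `0 ≤ b ≤ n`. -/
def zchoose (n : ℕ) (b : ℤ) : ℕ := if 0 ≤ b then n.choose b.toNat else 0

/-- The number of ones in a binary word of length `n`. -/
def ones {n : ℕ} (u : Fin n → Bool) : ℕ := (Finset.univ.filter fun j => u j = true).card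

/-- The partial sum `d_s = ∑_{j=1}^{s} (u_j - v_j)` (computed in `ℤ`). -/
def dval {n : ℕ} (u v : Fin n → Bool) (s : ℕ) : ℤ :=
  ∑ j ∈ Finset.univ.filter (fun j : Fin n => (j : ℕ) < s),
    ((if u j then 1 else 0) - (if v j then 1 else 0) : ℤ)

theorem zchoose_succ (n : ℕ) (b : ℤ) :
    zchoose (n + 1) b = zchoose n b + zchoose n (b - 1) := by
  unfold zchoose
  rcases lt_trichotomy b 0 with h | rfl | h
  · rw [if_neg (by omega), if_neg (by omega), if_neg (by omega)]
  · simp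
  · obtain ⟨m, rfl⟩ : ∃ m : ℕ, b = (m : ℤ) + 1 := ⟨(b - 1).toNat, by omega⟩
    rw [if_pos (by omega), if_pos (by omega), if_pos (by omega)]
    rw [show ((m : ℤ) + 1).toNat = m + 1 by omega, show ((m : ℤ) + 1 - 1).toNat = m by omega,
      Nat.choose_succ_succ, add_comm]

theorem zchoose_eq_zero_of_neg (n : ℕ) {b : ℤ} (h : b < 0) : zchoose n b = 0 :=
  if_neg (by omega)

theorem zchoose_eq_zero_of_lt (n : ℕ) {b : ℤ} (h : (n : ℤ) < b) : zchoose n b = 0 := by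
  unfold zchoose
  rw [if_pos (by omega), Nat.choose_eq_zero_of_lt (by omega)]

theorem zchoose_zero (b : ℤ) : zchoose 0 b = if b = 0 then 1 else 0 := by
  rcases lt_trichotomy b 0 with h | rfl | h
  · rw [zchoose_eq_zero_of_neg 0 h, if_neg h.ne]
  · simp [zchoose]
  · rw [zchoose_eq_zero_of_lt 0 (by simpa using h), if_neg h.ne']

theorem zchoose_symm (n : ℕ) (b : ℤ) : zchoose n (n - b) = zchoose n b := by
  rcases lt_or_ge b 0 with h | h
  · rw [zchoose_eq_zero_of_neg n h, zchoose_eq_zero_of_lt n (by omega)]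
  rcases lt_or_ge (n : ℤ) b with h' | h'
  · rw [zchoose_eq_zero_of_lt n h', zchoose_eq_zero_of_neg n (by omega)]
  unfold zchoose
  rw [if_pos (by omega), if_pos h, show ((n : ℤ) - b).toNat = n - b.toNat by omega,
    Nat.choose_symm (by omega)]

/-- The number of pairs of binary words of length `n` with `a` and `b` ones respectively. -/
def pairCount (n : ℕ) (a b : ℤ) : ℤ := zchoose n a * zchoose n b

theorem pairCount_succ (n : ℕ) (a b : ℤ) :
    pairCount (n + 1) a b = pairCount n a b + pairCount n (a - 1) b + pairCount n a (b - 1)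
      + pairCount n (a - 1) (b - 1) := by
  simp only [pairCount, zchoose_succ]
  push_cast
  ring

theorem summable_pairCount (n : ℕ) (a b c : ℤ) (hc : c ≠ 0) :
    Summable fun m : ℤ => pairCount n (a + c * m) (b - c * m) := by
  apply summable_of_hasFiniteSupport
  have hf : (Set.Icc (0 : ℤ) n).Finite := Set.finite_Icc _ _
  refine (hf.preimage (f := fun m : ℤ => a + c * m) fun x _ y _ h => ?_).subset fun m hm => ?_
  · exact mul_left_cancel₀ hc (add_left_cancel h)
  · by_contra hn
    simp only [Set.mem_preimage, Set.mem_Icc, not_and_or, not_le] at hn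
    apply hm
    rcases hn with h | h
    · simp [pairCount, zchoose_eq_zero_of_neg n h]
    · simp [pairCount, zchoose_eq_zero_of_lt n h]

/-- The signed count of pairs of words whose endpoint is an image of `(a, b)` under the group
generated by the reflections in the lines `a - b = k` and `a - b = -k`. -/
noncomputable def reflectionSum (k : ℤ) (n : ℕ) (a b : ℤ) : ℤ :=
  (∑' m : ℤ, pairCount n (a + 2 * k * m) (b - 2 * k * m))
    - ∑' m : ℤ, pairCount n (b + k + 2 * k * m) (a - k - 2 * k * m)

theorem tsum_pairCount_succ (n : ℕ) (a b c : ℤ) (hc : c ≠ 0) :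
    ∑' m : ℤ, pairCount (n + 1) (a + c * m) (b - c * m)
      = ∑' m : ℤ, pairCount n (a + c * m) (b - c * m)
        + ∑' m : ℤ, pairCount n (a - 1 + c * m) (b - c * m)
        + ∑' m : ℤ, pairCount n (a + c * m) (b - 1 - c * m)
        + ∑' m : ℤ, pairCount n (a - 1 + c * m) (b - 1 - c * m) := by
  have h1 := summable_pairCount n a b c hc
  have h2 := summable_pairCount n (a - 1) b c hc
  have h3 := summable_pairCount n a (b - 1) c hc
  have h4 := summable_pairCount n (a - 1) (b - 1) c hc
  rw [← h1.tsum_add h2, ← (h1.add h2).tsum_add h3, ← ((h1.add h2).add h3).tsum_add h4]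
  refine tsum_congr fun m => ?_
  rw [pairCount_succ, show a + c * m - 1 = a - 1 + c * m by ring,
    show b - c * m - 1 = b - 1 - c * m by ring]

theorem reflectionSum_succ {k : ℤ} (hk : 0 < k) (n : ℕ) (a b : ℤ) :
    reflectionSum k (n + 1) a b = reflectionSum k n a b + reflectionSum k n (a - 1) b
      + reflectionSum k n a (b - 1) + reflectionSum k n (a - 1) (b - 1) := by
  unfold reflectionSum
  rw [tsum_pairCount_succ n a b _ (by positivity),
    tsum_pairCount_succ n (b + k) (a - k) _ (by positivity),
    show b - 1 + k = b + k - 1 by ring, show a - 1 - k = a - k - 1 by ring]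
  ring

theorem reflectionSum_of_sub_eq (k : ℤ) (n : ℕ) {a b : ℤ} (h : a - b = k) :
    reflectionSum k n a b = 0 := by
  subst h
  unfold reflectionSum
  simp

theorem reflectionSum_of_sub_eq_neg (k : ℤ) (n : ℕ) {a b : ℤ} (h : a - b = -k) :
    reflectionSum k n a b = 0 := by
  obtain rfl : a = b - k := by linarith
  unfold reflectionSum
  rw [sub_eq_zero, ← (Equiv.subRight (1 : ℤ)).tsum_eq
    (fun m => pairCount n (b + k + 2 * k * m) (b - k - k - 2 * k * m))]
  refine tsum_congr fun m => ?_
  simp only [Equiv.subRight_apply]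
  congr 1 <;> ring

theorem reflectionSum_zero {k : ℤ} {a b : ℤ} (h1 : -k < a - b) (h2 : a - b < k) :
    reflectionSum k 0 a b = if a = 0 ∧ b = 0 then 1 else 0 := by
  have hp : ∀ x y : ℤ, pairCount 0 x y = if x = 0 ∧ y = 0 then 1 else 0 := by
    intro x y
    simp only [pairCount, zchoose_zero]
    split_ifs <;> simp_all
  have hm : ∀ m : ℤ, 0 < m → 2 * k ≤ 2 * k * m := fun m hm => by nlinarith
  have hm' : ∀ m : ℤ, m < 0 → 2 * k * m ≤ - (2 * k) := fun m hm => by nlinarith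
  unfold reflectionSum
  have hodd : ∑' m : ℤ, pairCount 0 (b + k + 2 * k * m) (a - k - 2 * k * m) = 0 := by
    rw [← tsum_zero (α := ℤ) (β := ℤ)]
    refine tsum_congr fun m => ?_
    rw [hp, if_neg]
    rintro ⟨h3, h4⟩
    rcases lt_or_ge m 0 with h | h
    · have := hm' m h
      omega
    · have : 0 ≤ 2 * k * m := mul_nonneg (by omega) h
      omega
  rw [hodd, tsum_eq_single 0, hp]
  · simp
  · intro m hm0
    rw [hp, if_neg]
    rintro ⟨h3, h4⟩
    rcases lt_or_gt_of_ne hm0 with h | h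
    · have := hm' m h
      omega
    · have := hm m h
      omega

theorem tsum_int_even_add_odd {f : ℤ → ℤ} (he : Summable fun m => f (2 * m))
    (ho : Summable fun m => f (2 * m + 1)) :
    ∑' m, f m = ∑' m, f (2 * m) + ∑' m, f (2 * m + 1) := by
  have hi : Function.Injective (2 * · : ℤ → ℤ) := mul_right_injective₀ two_ne_zero
  have ho' := ((add_left_injective 1).comp hi).hasSum_range_iff.2 ho.hasSum
  have heven : Set.range (2 * · : ℤ → ℤ) = {m | Even m} :=
    Set.ext fun m => ⟨fun ⟨x, hx⟩ => hx ▸ even_two_mul x,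
      fun h => ⟨m / 2, Int.two_mul_ediv_two_of_even h⟩⟩
  have hodd : Set.range ((· + 1 : ℤ → ℤ) ∘ (2 * ·)) = {m | Odd m} :=
    Set.ext fun m => ⟨fun ⟨x, hx⟩ => hx ▸ odd_two_mul_add_one x,
      fun h => ⟨m / 2, Int.two_mul_ediv_two_add_one_of_odd h⟩⟩
  refine ((hi.hasSum_range_iff.2 he.hasSum).add_isCompl ?_ ho').tsum_eq
  rw [heven, hodd]
  exact Int.isCompl_even_odd

/-- The reflection sum at a diagonal endpoint, as a single alternating sum. -/
theorem reflectionSum_self {k : ℤ} (hk : 0 < k) (n : ℕ) (a : ℤ) :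
    reflectionSum k n a a
      = ∑' l : ℤ, (-1 : ℤ) ^ l.natAbs * pairCount n (a + k * l) (a - k * l) := by
  have h1 := summable_pairCount n a a (2 * k) (by positivity)
  have h2 := summable_pairCount n (a + k) (a - k) (2 * k) (by positivity)
  have he : ∀ m : ℤ, (-1 : ℤ) ^ (2 * m).natAbs * pairCount n (a + k * (2 * m)) (a - k * (2 * m))
      = pairCount n (a + 2 * k * m) (a - 2 * k * m) := by
    intro m
    rw [(Int.natAbs_even.2 (even_two_mul m)).neg_one_pow, one_mul, ← mul_assoc, mul_comm k 2]
  have ho : ∀ m : ℤ, (-1 : ℤ) ^ (2 * m + 1).natAbs *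
      pairCount n (a + k * (2 * m + 1)) (a - k * (2 * m + 1))
      = -pairCount n (a + k + 2 * k * m) (a - k - 2 * k * m) := by
    intro m
    rw [(Int.natAbs_odd.2 (odd_two_mul_add_one m)).neg_one_pow, neg_one_mul,
      show a + k * (2 * m + 1) = a + k + 2 * k * m by ring,
      show a - k * (2 * m + 1) = a - k - 2 * k * m by ring]
  rw [tsum_int_even_add_odd (f := fun l => (-1 : ℤ) ^ l.natAbs * _)
      (h1.congr fun m => (he m).symm) (h2.neg.congr fun m => (ho m).symm),
    tsum_congr he, tsum_congr ho,
    tsum_neg, ← sub_eq_add_neg, reflectionSum]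

theorem ones_snoc {n : ℕ} (u : Fin n → Bool) (x : Bool) :
    ones (Fin.snoc u x : Fin (n + 1) → Bool) = ones u + x.toNat := by
  simp only [ones, Finset.card_filter, Fin.sum_univ_castSucc, Fin.snoc_castSucc, Fin.snoc_last]
  cases x <;> simp

theorem dval_of_le {n : ℕ} (u v : Fin n → Bool) {s : ℕ} (h : n ≤ s) :
    dval u v s = ones u - ones v := by
  unfold dval ones
  rw [Finset.filter_true_of_mem fun j _ => j.2.trans_le h, Finset.sum_sub_distrib]
  simp

theorem dval_snoc {n : ℕ} (u v : Fin n → Bool) (x y : Bool) {s : ℕ} (h : s ≤ n) :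
    dval (Fin.snoc u x : Fin (n + 1) → Bool) (Fin.snoc v y : Fin (n + 1) → Bool) s
      = dval u v s := by
  simp only [dval, Finset.sum_filter, Fin.sum_univ_castSucc, Fin.snoc_castSucc, Fin.val_castSucc,
    Fin.val_last, if_neg (not_lt.2 h), add_zero]

/-- The pair `(u, v)` ends at `(a, b)` and its partial sums stay strictly between `-k` and `k`. -/
def StaysIn (k : ℤ) {n : ℕ} (a b : ℤ) (u v : Fin n → Bool) : Prop :=
  (ones u : ℤ) = a ∧ (ones v : ℤ) = b ∧
    ∀ s ∈ Finset.Icc 1 n, -k < dval u v s ∧ dval u v s < k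

theorem staysIn_snoc {k a b : ℤ} (h1 : -k < a - b) (h2 : a - b < k) {n : ℕ}
    (u v : Fin n → Bool) (x y : Bool) :
    StaysIn k a b (Fin.snoc u x : Fin (n + 1) → Bool) (Fin.snoc v y : Fin (n + 1) → Bool)
      ↔ StaysIn k (a - x.toNat) (b - y.toNat) u v := by
  have hlast := dval_of_le (Fin.snoc u x : Fin (n + 1) → Bool)
    (Fin.snoc v y : Fin (n + 1) → Bool) le_rfl
  simp only [StaysIn, ← Finset.insert_Icc_right_eq_Icc_add_one (show 1 ≤ n + 1 by omega),
    Finset.forall_mem_insert, hlast]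
  simp only [ones_snoc, Nat.cast_add, eq_sub_iff_add_eq]
  refine and_congr_right fun ha => and_congr_right fun hb => ?_
  rw [ha, hb, and_iff_right ⟨h1, h2⟩]
  refine forall₂_congr fun s hs => ?_
  rw [dval_snoc u v x y (Finset.mem_Icc.1 hs).2]

open scoped Classical in
/-- The number of pairs of words of length `n` ending at `(a, b)` whose partial sums stay
strictly between `-k` and `k`. -/
noncomputable def confinedCount (k : ℤ) (n : ℕ) (a b : ℤ) : ℤ :=
  ∑ u : Fin n → Bool, ∑ v : Fin n → Bool, if StaysIn k a b u v then 1 else 0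

theorem sum_snoc {n : ℕ} (f : (Fin (n + 1) → Bool) → ℤ) :
    ∑ u, f u = ∑ u : Fin n → Bool, (f (Fin.snoc u true) + f (Fin.snoc u false)) := by
  rw [← (Fin.snocEquiv fun _ : Fin (n + 1) => Bool).sum_comp, Fintype.sum_prod_type,
    Fintype.sum_bool, Finset.sum_add_distrib]
  rfl

open scoped Classical in
theorem confinedCount_succ {k a b : ℤ} (h1 : -k < a - b) (h2 : a - b < k) (n : ℕ) :
    confinedCount k (n + 1) a b = confinedCount k n a b + confinedCount k n (a - 1) b
      + confinedCount k n a (b - 1) + confinedCount k n (a - 1) (b - 1) := by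
  have hxy : ∀ x y : Bool, confinedCount k n (a - x.toNat) (b - y.toNat)
      = ∑ u : Fin n → Bool, ∑ v : Fin n → Bool,
        if StaysIn k a b (Fin.snoc u x : Fin (n + 1) → Bool) (Fin.snoc v y) then 1 else 0 :=
    fun x y => Finset.sum_congr rfl fun u _ => Finset.sum_congr rfl fun v _ =>
      if_congr (staysIn_snoc h1 h2 u v x y).symm rfl rfl
  have htt := hxy true true
  have htf := hxy true false
  have hft := hxy false true
  have hff := hxy false false
  simp only [Bool.toNat_true, Bool.toNat_false, Nat.cast_one, Nat.cast_zero, sub_zero]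
    at htt htf hft hff
  rw [htt, htf, hft, hff]
  simp only [confinedCount, sum_snoc, Finset.sum_add_distrib]
  ring

theorem confinedCount_zero (k a b : ℤ) :
    confinedCount k 0 a b = if a = 0 ∧ b = 0 then 1 else 0 := by
  simp [confinedCount, StaysIn, ones, @eq_comm ℤ 0]

theorem confinedCount_eq_zero {k : ℤ} (hk : 0 < k) (n : ℕ) {a b : ℤ}
    (h : a - b = k ∨ a - b = -k) : confinedCount k n a b = 0 := by
  refine Finset.sum_eq_zero fun u _ => Finset.sum_eq_zero fun v _ => if_neg ?_
  rintro ⟨rfl, rfl, hs⟩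
  rw [← dval_of_le u v le_rfl] at h
  rcases Nat.eq_zero_or_pos n with rfl | hn
  · simp [dval] at h
    omega
  · have := hs n (Finset.mem_Icc.2 ⟨hn, le_rfl⟩)
    omega

/-- The reflection principle for pairs of binary words confined to a strip. -/
theorem confinedCount_eq_reflectionSum {k : ℤ} (hk : 0 < k) (n : ℕ) :
    ∀ a b : ℤ, -k ≤ a - b → a - b ≤ k → confinedCount k n a b = reflectionSum k n a b := by
  induction n with
  | zero =>
    intro a b h1 h2
    rcases h2.eq_or_lt with h | h2
    · rw [confinedCount_eq_zero hk _ (.inl h), reflectionSum_of_sub_eq _ _ h]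
    rcases h1.eq_or_lt' with h | h1
    · rw [confinedCount_eq_zero hk _ (.inr h), reflectionSum_of_sub_eq_neg _ _ h]
    rw [confinedCount_zero, reflectionSum_zero h1 h2]
  | succ n ih =>
    intro a b h1 h2
    rcases h2.eq_or_lt with h | h2
    · rw [confinedCount_eq_zero hk _ (.inl h), reflectionSum_of_sub_eq _ _ h]
    rcases h1.eq_or_lt' with h | h1
    · rw [confinedCount_eq_zero hk _ (.inr h), reflectionSum_of_sub_eq_neg _ _ h]
    rw [confinedCount_succ h1 h2, reflectionSum_succ hk, ih a b (by omega) (by omega),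
      ih (a - 1) b (by omega) (by omega), ih a (b - 1) (by omega) (by omega),
      ih (a - 1) (b - 1) (by omega) (by omega)]

open scoped Classical in
theorem stmt5 (k M N : ℕ) (hk : 0 < k) :
    ((Finset.univ.filter fun uv : (Fin (M + N) → Bool) × (Fin (M + N) → Bool) =>
        ones uv.1 = M ∧ ones uv.2 = M ∧
        ∀ s ∈ Finset.Icc 1 (M + N),
          -(k : ℤ) < dval uv.1 uv.2 s ∧ dval uv.1 uv.2 s < k).card : ℤ)
    = ∑ l ∈ Finset.Icc (-((M : ℤ) + N)) ((M : ℤ) + N),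
        (-1 : ℤ) ^ l.natAbs *
          ((zchoose (M + N) ((M : ℤ) - k * l) : ℤ) * (zchoose (M + N) ((N : ℤ) - k * l) : ℤ)) := by
  have hk' : (0 : ℤ) < k := by exact_mod_cast hk
  have hcount := confinedCount_eq_reflectionSum hk' (M + N) M M (by omega) (by omega)
  rw [reflectionSum_self hk'] at hcount
  convert hcount using 1
  · rw [Finset.card_filter, Nat.cast_sum, Fintype.sum_prod_type]
    simp [confinedCount, StaysIn]
  · rw [tsum_eq_sum (s := Finset.Icc (-((M : ℤ) + N)) ((M : ℤ) + N))]
    · refine Finset.sum_congr rfl fun l _ => ?_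
      rw [pairCount, ← zchoose_symm (M + N) (N - k * l), mul_comm (zchoose _ (_ + _) : ℤ)]
      congr 4
      push_cast
      ring
    · intro l hl
      rw [Finset.mem_Icc, not_and_or, not_le, not_le] at hl
      rw [pairCount]
      rcases hl with hl | hl
      · rw [zchoose_eq_zero_of_neg _ (show (M : ℤ) + k * l < 0 by nlinarith)]
        simp
      · rw [zchoose_eq_zero_of_neg _ (show (M : ℤ) - k * l < 0 by nlinarith)]
        simp
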